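/- Let N, and for each player i ∈ {1,…,N}, let S^i be a nonempty compact convex subset of ℝ^{n_i}, and let u^i : ∏_j S^j → ℝ be continuous and such that s^i ↦ u^i(s^i, s^{-i}) is concave for each fixed s^{-i}. Then there exists a Nash equilibrium: a profile s* with u^i(s*) ≥ u^i(t^i, s*^{-i}) for every i and every t^i ∈ S^i. -/

import Mathlib

/-- A finite set `σ` is dominant for a family of rankings `r i` if no point is ranked strictly
above the lowest point of `σ` in every ranking simultaneously. -/
def IsDominant {ι T : Type*} (r : ι → T → ℕ) (σ : Finset T) : Prop :=
  ∀ t, ∃ i, ∀ x ∈ σ, r i t ≤ r i x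

theorem IsDominant.mono {ι T : Type*} {r : ι → T → ℕ} {σ τ : Finset T}
    (h : IsDominant r σ) (hτ : τ ⊆ σ) : IsDominant r τ := fun t =>
  (h t).imp fun _ hi x hx => hi x (hτ hx)

/-- Pivoting: if the minimizers `m l` with `l ≠ k` enumerate the dominant set `τ` without repetition,
there is exactly one point that ranks below `τ` for `k` and keeps `τ` dominant when added. -/
theorem IsDominant.exists_completion {ι T : Type*} [Fintype T] [DecidableEq T]
    {r : ι → T → ℕ} (hr : ∀ i, Function.Injective (r i)) {τ : Finset T}
    (hτ : IsDominant r τ) {m : ι → T} (hmτ : ∀ i, m i ∈ τ)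
    (hmin : ∀ i, ∀ x ∈ τ, r i (m i) ≤ r i x) {k : ι}
    (hsurj : ∀ t ∈ τ, ∃ l, l ≠ k ∧ m l = t)
    (hinj : ∀ l l', l ≠ k → l' ≠ k → m l = m l' → l = l')
    (hM : ∃ x, ∀ l, l ≠ k → r l (m l) < r l x) :
    ∃ x, x ∉ τ ∧ IsDominant r (insert x τ) ∧ r k x < r k (m k) ∧
      (∀ l, l ≠ k → r l (m l) < r l x) ∧
      ∀ y, IsDominant r (insert y τ) → r k y < r k (m k) → y = x := by
  classical
  obtain ⟨x, hx, hxmax⟩ := Finset.exists_max_image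
    (Finset.univ.filter fun x => ∀ l, l ≠ k → r l (m l) < r l x) (r k)
    (by obtain ⟨x, hx⟩ := hM; exact ⟨x, by simpa using hx⟩)
  simp only [Finset.mem_filter, Finset.mem_univ, true_and] at hx hxmax
  have hxτ : x ∉ τ := by
    intro h
    obtain ⟨l, hl, rfl⟩ := hsurj x h
    exact lt_irrefl _ (hx l hl)
  have hxk : ∀ z ∈ τ, r k x ≤ r k z := by
    obtain ⟨l, hl⟩ := hτ x
    by_cases hlk : l = k
    · exact hlk ▸ hl
    · exact absurd (hl _ (hmτ l)) (not_le.2 (hx l hlk))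
  refine ⟨x, hxτ, ?_, ?_, hx, ?_⟩
  · intro t
    by_cases ht : ∀ l, l ≠ k → r l (m l) < r l t
    · refine ⟨k, fun z hz => ?_⟩
      rcases Finset.mem_insert.1 hz with rfl | hz
      · exact hxmax t ht
      · exact (hxmax t ht).trans (hxk z hz)
    · push Not at ht
      obtain ⟨l, hl, htl⟩ := ht
      refine ⟨l, fun z hz => ?_⟩
      rcases Finset.mem_insert.1 hz with rfl | hz
      · exact htl.trans (hx l hl).le
      · exact htl.trans (hmin l z hz)
  · refine lt_of_le_of_ne (hxk _ (hmτ k)) fun h => hxτ ?_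
    rw [hr k h]
    exact hmτ k
  · intro y hy hyk
    have hyM : ∀ l, l ≠ k → r l (m l) < r l y := by
      intro l hl
      obtain ⟨l', hl'⟩ := hy (m l)
      have h1 : m l' = m l := hr l' <| le_antisymm (hmin l' _ (hmτ l))
        (hl' _ (Finset.mem_insert_of_mem (hmτ l')))
      have h2 := hl' y (Finset.mem_insert_self _ _)
      have h3 : l' ≠ k := by
        rintro rfl
        rw [← h1] at h2
        omega
      obtain rfl := hinj _ _ h3 hl h1
      refine lt_of_le_of_ne h2 fun h => ?_
      have hyτ : y ∈ τ := hr l' h ▸ hmτ l'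
      rw [Finset.insert_eq_of_mem hyτ] at hy
      exact absurd (hmin k y hyτ) (not_le.2 hyk)
    obtain ⟨l, hl⟩ := hy x
    by_cases hlk : l = k
    · subst hlk
      exact hr l (le_antisymm (hxmax y hyM) (hl y (Finset.mem_insert_self _ _)))
    · exact absurd (hl _ (Finset.mem_insert_of_mem (hmτ l))) (not_le.2 (hx l hlk))

theorem IsDominant.exists_pair_completion {ι T : Type*} [Fintype ι] [Fintype T] [DecidableEq T]
    {r : ι → T → ℕ} (hr : ∀ i, Function.Injective (r i)) {τ : Finset T}
    (hτ : IsDominant r τ) (hne : τ.Nonempty) (hcard : τ.card + 1 = Fintype.card ι)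
    (hM : ∀ k, ∃ x, ∀ l, l ≠ k → ∃ y ∈ τ, r l y < r l x) :
    ∃ a b, a ≠ b ∧ ∀ x, (x ∉ τ ∧ IsDominant r (insert x τ)) ↔ x = a ∨ x = b := by
  classical
  choose m hmτ hmin using fun i => Finset.exists_min_image τ (r i) hne
  have hM' : ∀ k, ∃ x, ∀ l, l ≠ k → r l (m l) < r l x := fun k =>
    (hM k).imp fun x hx l hl => by
      obtain ⟨y, hy, hyx⟩ := hx l hl
      exact (hmin l y hy).trans_lt hyx
  have hsurj : ∀ t ∈ τ, ∃ l, m l = t := by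
    intro t ht
    obtain ⟨l, hl⟩ := hτ t
    exact ⟨l, hr l (le_antisymm (hmin l t ht) (hl _ (hmτ l)))⟩
  obtain ⟨i, -, j, -, hij, hmij⟩ := Finset.exists_ne_map_eq_of_card_lt_of_maps_to
    (s := Finset.univ) (t := τ) (f := m) (by rw [Finset.card_univ]; omega) (fun i _ => hmτ i)
  have key : ∀ k p, k ≠ p → m k = m p → (∀ t ∈ τ, ∃ l, l ≠ k ∧ m l = t) ∧
      ∀ l l', l ≠ k → l' ≠ k → m l = m l' → l = l' := by
    intro k p hkp hm
    have hs : ∀ t ∈ τ, ∃ l, l ≠ k ∧ m l = t := by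
      intro t ht
      obtain ⟨l, rfl⟩ := hsurj t ht
      by_cases hl : l = k
      · exact ⟨p, hkp.symm, by rw [hl, hm]⟩
      · exact ⟨l, hl, rfl⟩
    refine ⟨hs, ?_⟩
    have himg : (Finset.univ.erase k).image m = τ := by
      ext t
      simp only [Finset.mem_image, Finset.mem_erase, Finset.mem_univ, and_true]
      exact ⟨by rintro ⟨l, -, rfl⟩; exact hmτ l, hs t⟩
    have hinj : Set.InjOn m (Finset.univ.erase k : Finset ι) := by
      rw [← Finset.card_image_iff, himg, Finset.card_erase_of_mem (Finset.mem_univ k),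
        Finset.card_univ]
      omega
    intro l l' hl hl' h
    exact hinj (by simpa using hl) (by simpa using hl') h
  obtain ⟨hsi, hii⟩ := key i j hij hmij
  obtain ⟨hsj, hij'⟩ := key j i hij.symm hmij.symm
  obtain ⟨a, haτ, ha, hai, haM, hau⟩ := hτ.exists_completion hr hmτ hmin hsi hii (hM' i)
  obtain ⟨b, hbτ, hb, hbj, hbM, hbu⟩ := hτ.exists_completion hr hmτ hmin hsj hij' (hM' j)
  refine ⟨a, b, ?_, fun x => ⟨?_, ?_⟩⟩
  · rintro rfl
    exact absurd (hbM i hij) (not_lt.2 hai.le)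
  · rintro ⟨hxτ, hx⟩
    obtain ⟨k, hk⟩ := hτ x
    have hlt : r k x < r k (m k) := lt_of_le_of_ne (hk _ (hmτ k)) fun h =>
      hxτ (hr k h ▸ hmτ k)
    obtain ⟨l, hl⟩ := hx (m k)
    have hlk : l ≠ k := by
      rintro rfl
      exact absurd (hl x (Finset.mem_insert_self _ _)) (not_le.2 hlt)
    have hml : m l = m k := hr l (le_antisymm (hmin l _ (hmτ k))
      (hl _ (Finset.mem_insert_of_mem (hmτ l))))
    by_cases hki : k = i
    · exact Or.inl (hau x hx (hki ▸ hlt))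
    by_cases hkj : k = j
    · exact Or.inr (hbu x hx (hkj ▸ hlt))
    by_cases hli : l = i
    · exact absurd (hij' l k (hli ▸ hij) hkj hml) hlk
    · exact absurd (hii l k hli hki hml) hlk
  · rintro (rfl | rfl)
    · exact ⟨haτ, ha⟩
    · exact ⟨hbτ, hb⟩

theorem even_card_colored_facets {ι T : Type*} [Fintype ι] [DecidableEq ι] [DecidableEq T]
    (c : T → ι) (i₀ : ι) {σ : Finset T} (hcard : σ.card = Fintype.card ι)
    (hσ : ∃ i, ∀ x ∈ σ, c x ≠ i) :
    Even (σ.filter fun x => (σ.erase x).image c = Finset.univ.erase i₀).card := by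
  rcases (σ.filter fun x => (σ.erase x).image c = Finset.univ.erase i₀).eq_empty_or_nonempty
    with h | ⟨x, hx⟩
  · simp [h]
  rw [Finset.mem_filter] at hx
  obtain ⟨hxσ, hx⟩ := hx
  have hmem : ∀ i, i ∈ (σ.erase x).image c ↔ i ≠ i₀ := fun i => by simp [hx]
  have hinj : Set.InjOn c (σ.erase x : Finset T) := by
    rw [← Finset.card_image_iff, hx, Finset.card_erase_of_mem (Finset.mem_univ _),
      Finset.card_erase_of_mem hxσ, hcard, Finset.card_univ]
  have hcx : c x ≠ i₀ := by
    intro h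
    obtain ⟨i, hi⟩ := hσ
    by_cases hii : i = i₀
    · exact hi x hxσ (h.trans hii.symm)
    · obtain ⟨y, hy, hyi⟩ := Finset.mem_image.1 ((hmem i).2 hii)
      exact hi y (Finset.mem_of_mem_erase hy) hyi
  obtain ⟨y, hy, hyx⟩ := Finset.mem_image.1 ((hmem _).2 hcx)
  have hyx' : y ≠ x := Finset.ne_of_mem_erase hy
  have hset : (σ.filter fun x => (σ.erase x).image c = Finset.univ.erase i₀) = {x, y} := by
    ext z
    simp only [Finset.mem_filter, Finset.mem_insert, Finset.mem_singleton]
    constructor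
    · rintro ⟨hzσ, hz⟩
      by_contra! hne
      have hcz : c z ∈ (σ.erase z).image c := by
        rw [hz, ← hx]
        exact Finset.mem_image_of_mem c (Finset.mem_erase.2 ⟨hne.1, hzσ⟩)
      obtain ⟨w, hw, hwz⟩ := Finset.mem_image.1 hcz
      rw [Finset.mem_erase] at hw
      have hzx : z ∈ σ.erase x := Finset.mem_erase.2 ⟨hne.1, hzσ⟩
      by_cases hwx : w = x
      · exact hne.2 (hinj hzx hy (by rw [hyx, ← hwx, hwz]))
      · exact hw.1 (hinj (Finset.mem_coe.2 (Finset.mem_erase.2 ⟨hwx, hw.2⟩)) hzx hwz)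
    · rintro (rfl | rfl)
      · exact ⟨hxσ, hx⟩
      · refine ⟨Finset.mem_of_mem_erase hy, ?_⟩
        rw [← hx]
        ext i
        simp only [Finset.mem_image, Finset.mem_erase]
        constructor
        · rintro ⟨w, ⟨hw, hwσ⟩, rfl⟩
          by_cases hwx : w = x
          · exact ⟨z, ⟨hyx', Finset.mem_of_mem_erase hy⟩, by rw [hyx, hwx]⟩
          · exact ⟨w, ⟨hwx, hwσ⟩, rfl⟩
        · rintro ⟨w, ⟨hw, hwσ⟩, rfl⟩
          by_cases hwz : w = z
          · exact ⟨x, ⟨hyx'.symm, hxσ⟩, by rw [← hyx, hwz]⟩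
          · exact ⟨w, ⟨hwz, hwσ⟩, rfl⟩
  rw [hset, Finset.card_pair hyx'.symm]
  exact even_two

/-- Scarf's lemma: under any coloring there is a dominant set containing every color. The points
`e i` play the role of the boundary faces of a simplex. -/
theorem exists_isDominant_colorful {ι T : Type*} [Fintype ι] [Fintype T]
    {r : ι → T → ℕ} (hr : ∀ i, Function.Injective (r i)) (c : T → ι) (e : ι → T)
    (hce : ∀ i, c (e i) = i) (hbot : ∀ i x, r i (e i) ≤ r i x)
    (htop : ∀ i j, j ≠ i → ∀ t, t ∉ Set.range e → r i t < r i (e j))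
    (hT : ∃ t, t ∉ Set.range e) :
    ∃ σ, IsDominant r σ ∧ ∀ i, ∃ x ∈ σ, c x = i := by
  classical
  by_contra! hno
  obtain ⟨t₀, ht₀⟩ := hT
  set i₀ := c t₀
  set rooms : Finset (Finset T) :=
    Finset.univ.filter fun σ => σ.card = Fintype.card ι ∧ IsDominant r σ with hrooms
  set doors : Finset (Finset T) := Finset.univ.filter fun τ =>
    τ.card + 1 = Fintype.card ι ∧ τ.image c = Finset.univ.erase i₀ ∧ IsDominant r τ with hdoors
  have hcount := Finset.sum_card_bipartiteAbove_eq_sum_card_bipartiteBelow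
    (s := doors) (t := rooms) (fun τ σ => τ ⊆ σ)
  have heven : Even (∑ σ ∈ rooms, (doors.bipartiteBelow (fun τ σ => τ ⊆ σ) σ).card) := by
    refine Finset.even_sum _ fun σ hσ => ?_
    simp only [hrooms, Finset.mem_filter, Finset.mem_univ, true_and] at hσ
    suffices h : (σ.filter fun x => (σ.erase x).image c = Finset.univ.erase i₀).card =
        (doors.bipartiteBelow (fun τ σ => τ ⊆ σ) σ).card from
      h ▸ even_card_colored_facets c i₀ hσ.1 (hno σ hσ.2)
    refine Finset.card_bij (fun x _ => σ.erase x) ?_ ?_ ?_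
    · intro x hx
      rw [Finset.mem_filter] at hx
      simp only [Finset.mem_bipartiteBelow, hdoors, Finset.mem_filter, Finset.mem_univ, true_and]
      exact ⟨⟨by rw [Finset.card_erase_add_one hx.1, hσ.1], hx.2,
        hσ.2.mono (Finset.erase_subset _ _)⟩, Finset.erase_subset _ _⟩
    · intro x hx y hy h
      rw [Finset.mem_filter] at hx hy
      exact (Finset.erase_inj σ hx.1).1 h
    · intro τ hτ
      simp only [Finset.mem_bipartiteBelow, hdoors, Finset.mem_filter, Finset.mem_univ,
        true_and] at hτ
      obtain ⟨⟨h1, h2, -⟩, h3⟩ := hτ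
      obtain ⟨x, hx⟩ := Finset.card_eq_one.1
        (show (σ \ τ).card = 1 by rw [Finset.card_sdiff_of_subset h3]; omega)
      have hxσ : x ∈ σ \ τ := hx ▸ Finset.mem_singleton_self x
      have hτ' : σ.erase x = τ := by
        rw [Finset.erase_eq, ← hx, Finset.sdiff_sdiff_eq_self h3]
      exact ⟨x, by rw [Finset.mem_filter, hτ']; exact ⟨(Finset.mem_sdiff.1 hxσ).1, h2⟩, hτ'⟩
  have habove : ∀ τ ∈ doors, (rooms.bipartiteAbove (fun τ σ => τ ⊆ σ) τ).card =
      (Finset.univ.filter fun x => x ∉ τ ∧ IsDominant r (insert x τ)).card := by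
    intro τ hτ
    simp only [hdoors, Finset.mem_filter, Finset.mem_univ, true_and] at hτ
    symm
    refine Finset.card_bij (fun x _ => insert x τ) ?_ ?_ ?_
    · intro x hx
      simp only [Finset.mem_filter, Finset.mem_univ, true_and] at hx
      simp only [Finset.mem_bipartiteAbove, hrooms, Finset.mem_filter, Finset.mem_univ, true_and]
      exact ⟨⟨by rw [Finset.card_insert_of_notMem hx.1, hτ.1], hx.2⟩, Finset.subset_insert _ _⟩
    · intro x hx y hy h
      simp only [Finset.mem_filter, Finset.mem_univ, true_and] at hx hy
      exact (Finset.insert_inj hx.1).1 h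
    · intro σ hσ
      simp only [Finset.mem_bipartiteAbove, hrooms, Finset.mem_filter, Finset.mem_univ,
        true_and] at hσ
      obtain ⟨⟨h1, h2⟩, h3⟩ := hσ
      obtain ⟨x, hx⟩ := Finset.card_eq_one.1
        (show (σ \ τ).card = 1 by rw [Finset.card_sdiff_of_subset h3]; omega)
      have hxσ : x ∈ σ \ τ := hx ▸ Finset.mem_singleton_self x
      have hσ' : insert x τ = σ := by
        rw [Finset.insert_eq, ← hx, Finset.sdiff_union_of_subset h3]
      refine ⟨x, ?_, hσ'⟩
      simp only [Finset.mem_filter, Finset.mem_univ, true_and]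
      exact ⟨(Finset.mem_sdiff.1 hxσ).2, hσ' ▸ h2⟩
  set τ₀ : Finset T := (Finset.univ.erase i₀).image e with hτ₀
  have he : Function.Injective e := fun i j h => by rw [← hce i, ← hce j, h]
  have hemem : ∀ j, e j ∈ τ₀ ↔ j ≠ i₀ := fun j => by
    simp [hτ₀, he.eq_iff]
  have hτ₀mem : ∀ x ∈ τ₀, ∃ j, j ≠ i₀ ∧ e j = x := fun x hx => by
    simpa [hτ₀] using hx
  have hτ₀door : τ₀ ∈ doors := by
    simp only [hdoors, Finset.mem_filter, Finset.mem_univ, true_and]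
    refine ⟨?_, ?_, ?_⟩
    · rw [hτ₀, Finset.card_image_of_injective _ he,
        Finset.card_erase_add_one (Finset.mem_univ _), Finset.card_univ]
    · rw [hτ₀, Finset.image_image]
      simp [Function.comp_def, hce]
    · intro t
      by_cases ht : t ∈ Set.range e
      · obtain ⟨j, rfl⟩ := ht
        exact ⟨j, fun x _ => hbot j x⟩
      · refine ⟨i₀, fun x hx => ?_⟩
        obtain ⟨j, hj, rfl⟩ := hτ₀mem x hx
        exact (htop i₀ j hj t ht).le
  have hodd₀ : (rooms.bipartiteAbove (fun τ σ => τ ⊆ σ) τ₀).card = 1 := by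
    rw [habove τ₀ hτ₀door, Finset.card_eq_one]
    obtain ⟨a, ha, hamax⟩ := Finset.exists_max_image
      (Finset.univ.filter fun x => x ∉ Set.range e) (r i₀) ⟨t₀, by simpa using ht₀⟩
    simp only [Finset.mem_filter, Finset.mem_univ, true_and] at ha hamax
    have hlow : ∀ x t, t ∉ Set.range e → IsDominant r (insert x τ₀) → r i₀ t ≤ r i₀ x := by
      intro x t ht h
      obtain ⟨i, hi⟩ := h t
      by_cases hii : i = i₀
      · exact hii ▸ hi x (Finset.mem_insert_self _ _)
      · have := hi (e i) (Finset.mem_insert_of_mem ((hemem i).2 hii))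
        exact absurd ⟨i, (hr i (le_antisymm this (hbot i t))).symm⟩ ht
    refine ⟨a, ?_⟩
    ext x
    simp only [Finset.mem_filter, Finset.mem_univ, true_and, Finset.mem_singleton]
    constructor
    · rintro ⟨hx, hdom⟩
      have hax := hlow x a ha hdom
      have hxe : x ∉ Set.range e := by
        rintro ⟨j, rfl⟩
        have hj : j = i₀ := by
          by_contra hj
          exact hx ((hemem j).2 hj)
        subst hj
        exact ha ⟨_, (hr _ (le_antisymm hax (hbot _ a))).symm⟩
      exact hr i₀ (le_antisymm (hamax x hxe) hax)
    · rintro rfl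
      refine ⟨fun h => ?_, fun t => ?_⟩
      · obtain ⟨j, -, hj⟩ := hτ₀mem x h
        exact ha ⟨j, hj⟩
      · by_cases ht : t ∈ Set.range e
        · obtain ⟨j, rfl⟩ := ht
          exact ⟨j, fun x _ => hbot j x⟩
        · refine ⟨i₀, fun y hy => ?_⟩
          rcases Finset.mem_insert.1 hy with rfl | hy
          · exact hamax t ht
          · obtain ⟨j, hj, rfl⟩ := hτ₀mem y hy
            exact (htop i₀ j hj t ht).le
  have heven' : Even (∑ τ ∈ doors.erase τ₀,
      (rooms.bipartiteAbove (fun τ σ => τ ⊆ σ) τ).card) := by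
    refine Finset.even_sum _ fun τ hτ => ?_
    rw [Finset.mem_erase] at hτ
    obtain ⟨hne, hτ⟩ := hτ
    rw [habove τ hτ]
    simp only [hdoors, Finset.mem_filter, Finset.mem_univ, true_and] at hτ
    obtain ⟨hcard, himg, hdom⟩ := hτ
    obtain ⟨s, hsτ, hs⟩ : ∃ s ∈ τ, s ∉ Set.range e := by
      by_contra! hall
      refine hne (Finset.eq_of_subset_of_card_le ?_ ?_)
      · intro x hx
        obtain ⟨j, rfl⟩ := hall x hx
        have : c (e j) ∈ τ.image c := Finset.mem_image_of_mem c hx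
        rw [himg, hce] at this
        exact (hemem j).2 (Finset.ne_of_mem_erase this)
      · have := hτ₀door
        simp only [hdoors, Finset.mem_filter, Finset.mem_univ, true_and] at this
        omega
    obtain ⟨a, b, hab, h⟩ := hdom.exists_pair_completion hr ⟨s, hsτ⟩ hcard
      fun k => ⟨e k, fun l hl => ⟨s, hsτ, htop l k hl.symm s hs⟩⟩
    have : (Finset.univ.filter fun x => x ∉ τ ∧ IsDominant r (insert x τ)) = {a, b} := by
      ext x
      simp [h x]
    rw [this, Finset.card_pair hab]
    exact even_two
  rw [← Finset.add_sum_erase _ _ hτ₀door, hodd₀] at hcount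
  rw [← hcount] at heven
  exact absurd heven (by rw [Nat.not_even_iff_odd]; exact odd_one.add_even heven')

theorem exists_injective_refinement {T : Type*} [Finite T] (f : T → ℕ) :
    ∃ r : T → ℕ, Function.Injective r ∧ ∀ x y, f x < f y → r x < r y := by
  obtain ⟨M, ⟨q⟩⟩ := Finite.exists_equiv_fin T
  have hlt : ∀ x y, f x < f y → f x * M + q x < f y * M + q y := fun x y h => by
    have h1 : (f x + 1) * M ≤ f y * M := Nat.mul_le_mul_right M h
    have h2 := (q x).isLt
    rw [add_mul] at h1
    omega
  refine ⟨fun x => f x * M + q x, fun x y h => ?_, hlt⟩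
  dsimp only at h
  rcases lt_trichotomy (f x) (f y) with h' | h' | h'
  · exact absurd h (hlt x y h').ne
  · rw [h'] at h
    exact q.injective (Fin.ext (by omega))
  · exact absurd h (hlt y x h').ne'

/-- A Sperner-type lemma on the grid of integer points of the dilated simplex, with no boundary
condition on the coloring. -/
theorem exists_almost_colorful_grid_point {ι : Type*} [Fintype ι] [Nonempty ι] (n : ℕ)
    (c : (ι → ℕ) → ι) :
    ∃ a : ι → ℕ, ∑ i, a i = n ∧ ∀ i, a i ≤ Fintype.card ι ∨
      ∃ b : ι → ℕ, ∑ k, b k = n ∧ c b = i ∧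
        ∀ k, b k ≤ a k + Fintype.card ι ∧ a k ≤ b k + Fintype.card ι := by
  classical
  let G := {a : ι → Fin (n + 1) // ∑ i, (a i : ℕ) = n}
  have mkG : ∀ a : ι → ℕ, ∑ i, a i = n → ∃ g : G, ∀ i, (g.1 i : ℕ) = a i := fun a ha =>
    ⟨⟨fun i => ⟨a i, Nat.lt_succ_of_le
      (ha ▸ Finset.single_le_sum (fun _ _ => Nat.zero_le _) (Finset.mem_univ i))⟩, ha⟩,
      fun i => rfl⟩
  let f : ι → G ⊕ ι → ℕ := fun i => Sum.elim (fun a => a.1 i + 1)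
    (fun j => if j = i then 0 else n + 2)
  choose r hr hlt using fun i => exists_injective_refinement (f i)
  let c' : G ⊕ ι → ι := Sum.elim (fun a => c fun i => a.1 i) id
  obtain ⟨g₀, -⟩ : ∃ g : G, True := by
    obtain ⟨g, -⟩ := mkG (Pi.single (Classical.arbitrary ι) n) (by simp)
    exact ⟨g, trivial⟩
  obtain ⟨σ, hσ, hcol⟩ := exists_isDominant_colorful hr c' Sum.inr (fun i => rfl)
    (by
      intro i x
      rcases x with a | j
      · exact (hlt i _ _ (by simp [f])).le
      · by_cases hj : j = i
        · rw [hj]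
        · exact (hlt i _ _ (by simp [f, hj])).le)
    (by
      intro i j hj t ht
      rcases t with a | k
      · refine hlt i _ _ ?_
        have := (a.1 i).isLt
        simp only [f, Sum.elim_inl, Sum.elim_inr, if_neg hj]
        omega
      · exact absurd ⟨k, rfl⟩ ht)
    ⟨Sum.inl g₀, by simp⟩
  have hdom : ∀ t, ∃ i, ∀ x ∈ σ, f i t ≤ f i x := fun t => by
    obtain ⟨i, hi⟩ := hσ t
    exact ⟨i, fun x hx => not_lt.1 fun h => absurd (hi x hx) (not_le.2 (hlt i _ _ h))⟩
  have hσne : σ.Nonempty := (hcol (Classical.arbitrary ι)).imp fun _ h => h.1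
  choose m hmσ hmin using fun i => Finset.exists_min_image σ (f i) hσne
  set M : ι → ℕ := fun i => f i (m i) with hMdef
  have hM0 : ∀ i, Sum.inr i ∈ σ → M i = 0 := fun i hi => by
    have := hmin i _ hi
    simp only [f, Sum.elim_inr, if_true] at this
    exact Nat.le_zero.1 this
  have hsum : n < ∑ i, M i := by
    by_contra! h
    let i₁ := Classical.arbitrary ι
    obtain ⟨g, hg⟩ := mkG (M + Pi.single i₁ (n - ∑ i, M i)) (by
      simp only [Pi.add_apply, Finset.sum_add_distrib, Finset.sum_pi_single',
        Finset.mem_univ, if_true]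
      omega)
    obtain ⟨i, hi⟩ := hdom (Sum.inl g)
    have h1 := hi _ (hmσ i)
    have h2 := hg i
    simp only [f, Sum.elim_inl, Pi.add_apply] at h1 h2
    change _ ≤ M i at h1
    omega
  have hle : ∀ g : G, Sum.inl g ∈ σ → ∀ i, M i ≤ g.1 i + 1 := fun g hg i => by
    simpa [f] using hmin i _ hg
  have hge : ∀ g : G, Sum.inl g ∈ σ → ∀ i, g.1 i + 1 ≤ M i + Fintype.card ι := fun g hg i => by
    have h1 : ∑ k ∈ Finset.univ.erase i, M k ≤ ∑ k ∈ Finset.univ.erase i, ((g.1 k : ℕ) + 1) :=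
      Finset.sum_le_sum fun k _ => hle g hg k
    have h2 := Finset.add_sum_erase Finset.univ M (Finset.mem_univ i)
    have h3 := Finset.add_sum_erase Finset.univ (fun k => (g.1 k : ℕ) + 1) (Finset.mem_univ i)
    have h4 : ∑ k, ((g.1 k : ℕ) + 1) = n + Fintype.card ι := by
      rw [Finset.sum_add_distrib, g.2]
      simp
    omega
  obtain ⟨g, hg⟩ : ∃ g : G, Sum.inl g ∈ σ := by
    by_contra! h
    have : ∀ i, M i = 0 := fun i => by
      obtain ⟨x, hx, hxi⟩ := hcol i
      rcases x with a | j
      · exact absurd hx (h a)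
      · exact hM0 i (by simpa [← hxi, c'] using hx)
    simp [this] at hsum
  refine ⟨fun i => g.1 i, g.2, fun i => ?_⟩
  obtain ⟨x, hx, hxi⟩ := hcol i
  rcases x with b | j
  · refine Or.inr ⟨fun i => b.1 i, b.2, hxi, fun k => ?_⟩
    have := hle g hg k
    have := hge g hg k
    have := hle b hx k
    have := hge b hx k
    dsimp only
    omega
  · obtain rfl : j = i := hxi
    have := hM0 j hx
    have := hge g hg j
    left
    dsimp only
    omega

/-- A Knaster–Kuratowski–Mazurkiewicz-type covering lemma: if closed sets `A i` cover the standard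
simplex, some point of the simplex lies in every `A i` for which its `i`-th coordinate is
nonzero. -/
theorem exists_mem_stdSimplex_forall_mem_or_eq_zero {ι : Type*} [Fintype ι] [Nonempty ι]
    (A : ι → Set (ι → ℝ)) (hA : ∀ i, IsClosed (A i))
    (hcov : ∀ x ∈ stdSimplex ℝ ι, ∃ i, x ∈ A i) :
    ∃ x ∈ stdSimplex ℝ ι, ∀ i, x ∈ A i ∨ x i = 0 := by
  classical
  let p : ℕ → (ι → ℕ) → ι → ℝ := fun n a i => (a i : ℝ) / (n + 1)
  have hp : ∀ n a, ∑ i, a i = n + 1 → p n a ∈ stdSimplex ℝ ι := by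
    intro n a ha
    refine ⟨fun i => by positivity, ?_⟩
    rw [← Finset.sum_div, ← Nat.cast_sum, ha]
    push_cast
    exact div_self (by positivity)
  have hc : ∀ n, ∃ c : (ι → ℕ) → ι, ∀ a, ∑ i, a i = n + 1 → p n a ∈ A (c a) := by
    intro n
    have : ∀ a : ι → ℕ, ∃ i, ∑ i, a i = n + 1 → p n a ∈ A i := fun a => by
      by_cases ha : ∑ i, a i = n + 1
      · exact (hcov _ (hp n a ha)).imp fun i hi _ => hi
      · exact ⟨Classical.arbitrary ι, fun h => absurd h ha⟩
    exact ⟨fun a => (this a).choose, fun a => (this a).choose_spec⟩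
  choose c hc using hc
  choose a ha hac using fun n => exists_almost_colorful_grid_point (n + 1) (c n)
  obtain ⟨x, hx, φ, hφ, hlim⟩ := (isCompact_stdSimplex ℝ ι).tendsto_subseq
    (fun n => hp n (a n) (ha n))
  refine ⟨x, hx, fun i => ?_⟩
  have hnear : ∀ n, ∃ z ∈ A i ∪ {v : ι → ℝ | v i = 0},
      dist (p n (a n)) z ≤ Fintype.card ι / (n + 1 : ℝ) := by
    intro n
    have hn : (0 : ℝ) < n + 1 := by positivity
    rcases hac n i with h | ⟨b, hb, hbi, hab⟩
    · refine ⟨Function.update (p n (a n)) i 0, Or.inr (by simp), ?_⟩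
      rw [dist_pi_le_iff (by positivity)]
      intro k
      by_cases hk : k = i
      · subst hk
        rw [Function.update_self, Real.dist_eq, sub_zero, abs_of_nonneg (by positivity)]
        exact div_le_div_of_nonneg_right (by exact_mod_cast h) hn.le
      · rw [Function.update_of_ne hk, dist_self]
        positivity
    · refine ⟨p n b, Or.inl (hbi ▸ hc n b hb), ?_⟩
      rw [dist_pi_le_iff (by positivity)]
      intro k
      rw [Real.dist_eq, ← sub_div, abs_div, abs_of_pos hn]
      refine div_le_div_of_nonneg_right ?_ hn.le
      obtain ⟨h1, h2⟩ := hab k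
      have h1' : (b k : ℝ) ≤ a n k + Fintype.card ι := by exact_mod_cast h1
      have h2' : (a n k : ℝ) ≤ b k + Fintype.card ι := by exact_mod_cast h2
      rw [abs_le]
      constructor <;> linarith
  choose z hz hdist using hnear
  have hzero : Filter.Tendsto (fun n : ℕ => (Fintype.card ι : ℝ) / (n + 1 : ℝ)) Filter.atTop
      (nhds 0) := by
    simpa [div_eq_mul_inv] using
      (tendsto_one_div_add_atTop_nhds_zero_nat (𝕜 := ℝ)).const_mul (Fintype.card ι : ℝ)
  have hzlim : Filter.Tendsto (z ∘ φ) Filter.atTop (nhds x) := by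
    refine hlim.congr_dist ?_
    exact squeeze_zero (fun _ => dist_nonneg) (fun n => hdist (φ n))
      (hzero.comp hφ.tendsto_atTop)
  have hclosed : IsClosed (A i ∪ {v : ι → ℝ | v i = 0}) :=
    (hA i).union (isClosed_eq (continuous_apply i) continuous_const)
  exact hclosed.mem_of_tendsto hzlim (Filter.Eventually.of_forall fun n => hz (φ n))

/-- **Ky Fan's inequality**. -/
theorem exists_forall_le_zero_of_concaveOn {E : Type*} [AddCommGroup E] [Module ℝ E]
    [TopologicalSpace E] [ContinuousAdd E] [ContinuousSMul ℝ E] [T2Space E] {K : Set E}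
    (hne : K.Nonempty) (hK : IsCompact K) (hconv : Convex ℝ K) (Φ : E → E → ℝ)
    (hcont : ∀ t ∈ K, ContinuousOn (fun s => Φ s t) K)
    (hconc : ∀ s ∈ K, ConcaveOn ℝ K (Φ s)) (hdiag : ∀ s ∈ K, Φ s s ≤ 0) :
    ∃ s ∈ K, ∀ t ∈ K, Φ s t ≤ 0 := by
  classical
  have hclosed : ∀ t : K, IsClosed {s | s ∈ K ∧ Φ s t ≤ 0} := fun t =>
    (hcont t t.2).preimage_isClosed_of_isClosed hK.isClosed isClosed_Iic
  suffices hfin : ∀ F : Finset K, (K ∩ ⋂ t ∈ F, {s | s ∈ K ∧ Φ s t ≤ 0}).Nonempty by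
    obtain ⟨s, hs, hs'⟩ := hK.inter_iInter_nonempty
      (fun t : K => {s | s ∈ K ∧ Φ s t ≤ 0}) hclosed hfin
    exact ⟨s, hs, fun t ht => (Set.mem_iInter.1 hs' ⟨t, ht⟩).2⟩
  intro F
  rcases F.eq_empty_or_nonempty with rfl | hF
  · simpa using hne
  have : Nonempty F := hF.to_subtype
  let p : (F → ℝ) → E := fun x => ∑ k, x k • (k.1 : E)
  have hpK : ∀ x ∈ stdSimplex ℝ F, p x ∈ K := fun x hx =>
    hconv.sum_mem (fun i _ => hx.1 i) hx.2 fun i _ => i.1.2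
  have hpcont : Continuous p := by fun_prop
  let g : F → (F → ℝ) → ℝ := fun k x => max 0 (Φ (p x) k.1)
  have hg : ∀ k, ContinuousOn (g k) (stdSimplex ℝ F) := fun k =>
    continuousOn_const.sup ((hcont k.1 k.1.2).comp hpcont.continuousOn hpK)
  have hg0 : ∀ k x, 0 ≤ g k x := fun k x => le_max_left _ _
  obtain ⟨x, hx, hxA⟩ := exists_mem_stdSimplex_forall_mem_or_eq_zero
    (fun k => {x | x ∈ stdSimplex ℝ F ∧ x k * ∑ j, g j x ≤ g k x})
    (fun k => by
      have h : ContinuousOn (fun x => x k * ∑ j, g j x - g k x) (stdSimplex ℝ F) :=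
        ((continuous_apply k).continuousOn.mul
          (continuousOn_finsetSum _ fun j _ => hg j)).sub (hg k)
      convert h.preimage_isClosed_of_isClosed (isClosed_stdSimplex ℝ F) (isClosed_Iic (a := 0))
        using 1
      ext x
      simp)
    (fun x hx => by
      by_contra! h
      have h' : ∀ k, g k x < x k * ∑ j, g j x := fun k => by
        by_contra hk
        exact h k ⟨hx, not_lt.1 hk⟩
      have := Finset.sum_lt_sum_of_nonempty (s := Finset.univ) Finset.univ_nonempty
        fun k _ => h' k
      rw [← Finset.sum_mul, hx.2, one_mul] at this
      exact lt_irrefl _ this)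
  have hle : ∀ k, x k * ∑ j, g j x ≤ g k x := fun k => by
    rcases hxA k with h | h
    · exact h.2
    · rw [h, zero_mul]
      exact hg0 k x
  have hsum : ∑ j, g j x ≤ 0 := by
    by_contra! hpos
    have hΦ : ∑ k, x k * Φ (p x) k.1 ≤ 0 :=
      ((hconc _ (hpK x hx)).le_map_sum (fun i _ => hx.1 i) hx.2 fun i _ => i.1.2).trans
        (hdiag _ (hpK x hx))
    have hnn : ∀ k, 0 ≤ x k * Φ (p x) k.1 := fun k => by
      rcases (hx.1 k).eq_or_lt with h | h
      · rw [← h, zero_mul]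
      · have h1 : 0 < g k x := (mul_pos h hpos).trans_le (hle k)
        exact (mul_pos h ((lt_max_iff.1 h1).resolve_left (lt_irrefl _))).le
    obtain ⟨k, hk⟩ : ∃ k, 0 < x k := by
      by_contra! h
      have := Finset.sum_nonpos (s := Finset.univ) fun k _ => h k
      rw [hx.2] at this
      linarith
    have h1 : 0 < g k x := (mul_pos hk hpos).trans_le (hle k)
    have h2 := mul_pos hk ((lt_max_iff.1 h1).resolve_left (lt_irrefl _))
    have h3 := Finset.single_le_sum (fun k _ => hnn k) (Finset.mem_univ k)
    linarith
  refine ⟨p x, hpK x hx, ?_⟩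
  simp only [Set.mem_iInter]
  intro t ht
  refine ⟨hpK x hx, ?_⟩
  have h1 := Finset.single_le_sum (fun k _ => hg0 k x) (Finset.mem_univ (⟨t, ht⟩ : F))
  exact (le_max_right 0 _).trans (h1.trans hsum)

/-- Nash/Glicksberg existence of equilibrium for concave games on compact
convex strategy sets in Euclidean spaces. -/
theorem nash_equilibrium_exists_concave_game
    (N : ℕ) (n : Fin N → ℕ)
    (S : ∀ i, Set (Fin (n i) → ℝ))
    (hne : ∀ i, (S i).Nonempty) (hcomp : ∀ i, IsCompact (S i))
    (hconv : ∀ i, Convex ℝ (S i))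
    (u : ∀ _ : Fin N, (∀ j, Fin (n j) → ℝ) → ℝ)
    (hcont : ∀ i, ContinuousOn (u i) {s | ∀ j, s j ∈ S j})
    (hconc : ∀ i, ∀ s : ∀ j, Fin (n j) → ℝ, (∀ j, s j ∈ S j) →
      ConcaveOn ℝ (S i) (fun t => u i (Function.update s i t))) :
    ∃ s : ∀ j, Fin (n j) → ℝ, (∀ j, s j ∈ S j) ∧
      ∀ i, ∀ t ∈ S i, u i (Function.update s i t) ≤ u i s := by
  have hmem : ∀ s ∈ {s : ∀ j, Fin (n j) → ℝ | ∀ j, s j ∈ S j}, ∀ i, ∀ t ∈ S i,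
      Function.update s i t ∈ {s : ∀ j, Fin (n j) → ℝ | ∀ j, s j ∈ S j} := by
    intro s hs i t ht j
    by_cases hj : j = i
    · subst hj
      rwa [Function.update_self]
    · rw [Function.update_of_ne hj]
      exact hs j
  have hpi : {s : ∀ j, Fin (n j) → ℝ | ∀ j, s j ∈ S j} = Set.univ.pi S := by
    ext s
    simp
  obtain ⟨s, hs, hmax⟩ := exists_forall_le_zero_of_concaveOn
    (K := {s : ∀ j, Fin (n j) → ℝ | ∀ j, s j ∈ S j})
    (by rw [hpi]; exact Set.univ_pi_nonempty_iff.2 hne)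
    (by rw [hpi]; exact isCompact_univ_pi hcomp)
    (by rw [hpi]; exact convex_pi fun i _ => hconv i)
    (fun s t => ∑ i, (u i (Function.update s i (t i)) - u i s))
    (fun t ht => continuousOn_finsetSum _ fun i _ =>
      ((hcont i).comp (continuous_id.update i continuous_const).continuousOn
        fun s hs => hmem s hs i _ (ht i)).sub (hcont i))
    (fun s hs => by
      have hK : Convex ℝ {s : ∀ j, Fin (n j) → ℝ | ∀ j, s j ∈ S j} := by
        rw [hpi]
        exact convex_pi fun i _ => hconv i
      refine ⟨hK, fun t ht t' ht' a b ha hb hab => ?_⟩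
      simp only [smul_eq_mul, Finset.mul_sum, ← Finset.sum_add_distrib]
      refine Finset.sum_le_sum fun i _ => ?_
      have h := (hconc i s hs).2 (ht i) (ht' i) ha hb hab
      simp only [smul_eq_mul] at h
      simp only [Pi.add_apply, Pi.smul_apply]
      have h' : (a + b) * u i s = u i s := by rw [hab, one_mul]
      linarith)
    (fun s _ => by simp)
  refine ⟨s, hs, fun i t ht => ?_⟩
  have h := hmax _ (hmem s hs i t ht)
  rw [Finset.sum_eq_single i] at h
  · simpa using h
  · intro j _ hj
    rw [Function.update_of_ne hj, Function.update_eq_self, sub_self]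
  · simp
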